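/- (Factorization lemma.) Let 𝕂 be ℝ or ℂ and let Q = U A with U ∈ 𝕂^{μ×m} and A ∈ 𝕂^{m×n}. Let Ĥ be the operator sending a block vector v : ZMod μ → 𝕂^m to Ĥ(v) = Σ_{k ∈ ZMod μ} S_k (U v_k) ∈ 𝕂^μ, and let H(w) = Σ_{k ∈ ZMod μ} S_k (Q w_k) for block vectors w : ZMod μ → 𝕂^n. Suppose: (i) Δ ≥ 0 satisfies |‖Ĥ(A w)‖² − ‖A w‖²| ≤ Δ ‖A w‖² for every (s,σ)-sparse block vector w : ZMod μ → 𝕂^n, where A w denotes the blockwise application k ↦ A w_k; (ii) δ ≥ 0 satisfies |‖A x‖² − ‖x‖²| ≤ δ ‖x‖² for every σ-sparse x ∈ 𝕂^n. Then for every (s,σ)-sparse block vector w : ZMod μ → 𝕂^n one has |‖H(w)‖² − ‖w‖²| ≤ (Δ + δ + Δ·δ) ‖w‖². In particular δ_{(s,σ)}(H) ≤ Δ_{s,σ}(Ĥ) + δ_σ(A) + Δ_{s,σ}(Ĥ)·δ_σ(A). -/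

import Mathlib

open Finset

/-- Squared Euclidean norm of a vector: `‖x‖² = Σ_i ‖x_i‖²`. -/
noncomputable def sqNorm {𝕂 : Type*} [RCLike 𝕂] {ι : Type*} [Fintype ι]
    (x : ι → 𝕂) : ℝ :=
  ∑ i, ‖x i‖ ^ 2

/-- Squared norm of a block vector: `‖w‖² = Σ_k ‖w_k‖²`. -/
noncomputable def blockSqNorm {𝕂 : Type*} [RCLike 𝕂] {μ : ℕ} [NeZero μ]
    {ι : Type*} [Fintype ι] (w : ZMod μ → ι → 𝕂) : ℝ :=
  ∑ k : ZMod μ, sqNorm (w k)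

/-- A vector is `σ`-sparse if its support has at most `σ` elements. -/
def SparseVec {𝕂 : Type*} [RCLike 𝕂] {ι : Type*} (σ : ℕ) (x : ι → 𝕂) : Prop :=
  Set.ncard {i | x i ≠ 0} ≤ σ

/-- A block vector is `(s,σ)`-sparse if at most `s` blocks are nonzero and every
block is `σ`-sparse. -/
def HiSparse {𝕂 : Type*} [RCLike 𝕂] {μ n : ℕ} (s σ : ℕ)
    (w : ZMod μ → Fin n → 𝕂) : Prop :=
  Set.ncard {k | w k ≠ 0} ≤ s ∧ ∀ k, SparseVec σ (w k)

/-- The shift operator `S_ℓ`: `(S_ℓ x)_k = x_{k+ℓ}`. -/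
def shiftOp {𝕂 : Type*} [RCLike 𝕂] {μ : ℕ} (ℓ : ZMod μ) (x : ZMod μ → 𝕂) :
    ZMod μ → 𝕂 :=
  fun k => x (k + ℓ)

/-- The lifted operator associated with a matrix `M`: `w ↦ Σ_k S_k (M w_k)`. -/
noncomputable def liftedOp {𝕂 : Type*} [RCLike 𝕂] {μ : ℕ} [NeZero μ]
    {ι : Type*} [Fintype ι] (M : Matrix (ZMod μ) ι 𝕂)
    (w : ZMod μ → ι → 𝕂) : ZMod μ → 𝕂 :=
  ∑ k : ZMod μ, shiftOp k (M.mulVec (w k))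

/-- Blockwise application of a matrix `A` to a block vector: `(A w)_k = A w_k`. -/
def blockApply {𝕂 : Type*} [RCLike 𝕂] {μ m n : ℕ}
    (A : Matrix (Fin m) (Fin n) 𝕂) (w : ZMod μ → Fin n → 𝕂) :
    ZMod μ → Fin m → 𝕂 :=
  fun k => A.mulVec (w k)

theorem liftedOp_mul {𝕂 : Type*} [RCLike 𝕂] {μ m n : ℕ} [NeZero μ]
    (U : Matrix (ZMod μ) (Fin m) 𝕂) (A : Matrix (Fin m) (Fin n) 𝕂)
    (w : ZMod μ → Fin n → 𝕂) :
    liftedOp (U * A) w = liftedOp U (blockApply A w) := by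
  simp only [liftedOp, blockApply, Matrix.mulVec_mulVec]

/-- A restricted isometry bound on every block is inherited by the block vector. -/
theorem abs_blockSqNorm_blockApply_sub_le {𝕂 : Type*} [RCLike 𝕂] {μ m n : ℕ} [NeZero μ]
    {A : Matrix (Fin m) (Fin n) 𝕂} {δ : ℝ} {w : ZMod μ → Fin n → 𝕂}
    (h : ∀ k, |sqNorm (A.mulVec (w k)) - sqNorm (w k)| ≤ δ * sqNorm (w k)) :
    |blockSqNorm (blockApply A w) - blockSqNorm w| ≤ δ * blockSqNorm w := by
  simp only [blockSqNorm, blockApply]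
  rw [← Finset.sum_sub_distrib, Finset.mul_sum]
  exact (Finset.abs_sum_le_sum_abs _ _).trans (Finset.sum_le_sum fun k _ => h k)

/-- Factorization lemma: if `Q = U A`, the operator `Ĥ` built
from `U` satisfies the restricted bound `Δ` on images of `(s,σ)`-sparse block
vectors under blockwise `A`, and `A` has `σ`-RIP constant `δ`, then the lifted
operator `H` built from `Q` has `(s,σ)`-HiRIP constant at most `Δ + δ + Δ·δ`. -/
theorem factorization_lemma {𝕂 : Type*} [RCLike 𝕂] {μ m n : ℕ} [NeZero μ]
    (U : Matrix (ZMod μ) (Fin m) 𝕂) (A : Matrix (Fin m) (Fin n) 𝕂)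
    (s σ : ℕ) (Δ δ : ℝ) (hΔ : 0 ≤ Δ) (hδ : 0 ≤ δ)
    (hU : ∀ w : ZMod μ → Fin n → 𝕂, HiSparse s σ w →
      |sqNorm (liftedOp U (blockApply A w)) - blockSqNorm (blockApply A w)| ≤
        Δ * blockSqNorm (blockApply A w))
    (hA : ∀ x : Fin n → 𝕂, SparseVec σ x →
      |sqNorm (A.mulVec x) - sqNorm x| ≤ δ * sqNorm x) :
    ∀ w : ZMod μ → Fin n → 𝕂, HiSparse s σ w →
      |sqNorm (liftedOp (U * A) w) - blockSqNorm w| ≤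
        (Δ + δ + Δ * δ) * blockSqNorm w := by
  intro w hw
  have hlift := hU w hw
  have hblock := abs_blockSqNorm_blockApply_sub_le fun k => hA (w k) (hw.2 k)
  have hle : blockSqNorm (blockApply A w) ≤ (1 + δ) * blockSqNorm w := by
    linarith [(abs_le.mp hblock).2]
  rw [liftedOp_mul]
  calc _ ≤ _ := abs_sub_le _ (blockSqNorm (blockApply A w)) _
    _ ≤ Δ * ((1 + δ) * blockSqNorm w) + δ * blockSqNorm w :=
      add_le_add (hlift.trans (mul_le_mul_of_nonneg_left hle hΔ)) hblock
    _ = (Δ + δ + Δ * δ) * blockSqNorm w := by ring
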